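/- For all integers n, k with k ≥ 2 and n ≥ k−1, writing q = ⌊n/(k−1)⌋, the following identity of partitions holds: (ρ_n +_H ((k−1)_V ρ_q)) +_V ( +_H_{i=0}^{k−1} ρ_{⌊(n+q−k+1+i)/k⌋} ) = ρ_{n+q}, where the inner sum is the horizontal sum over i = 0, 1, …, k−1. -/

import Mathlib

/-- A partition, encoded by its weakly decreasing (0-indexed) sequence of parts,
eventually zero.  The horizontal sum `+_H` is pointwise addition of part functions. -/
def IsPtnFun (f : ℕ → ℕ) : Prop :=
  Antitone f ∧ ∃ N, ∀ i, N ≤ i → f i = 0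

/-- The staircase partition `ρ_m = (m, m-1, …, 1)`. -/
def rho (m : ℕ) : ℕ → ℕ := fun i => m - i

/-- The conjugate partition: `(conjFun f) j = #{i : f i ≥ j + 1}`. -/
noncomputable def conjFun (f : ℕ → ℕ) : ℕ → ℕ := fun j => {i | j + 1 ≤ f i}.ncard

/-- The vertical sum `λ +_V μ = (λ' +_H μ')'`. -/
noncomputable def vsum (f g : ℕ → ℕ) : ℕ → ℕ := conjFun (conjFun f + conjFun g)

/-- `vmul k λ = k_V λ`, the vertical sum of `k` copies of `λ`. -/
noncomputable def vmul : ℕ → (ℕ → ℕ) → (ℕ → ℕ)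
  | 0, _ => 0
  | k + 1, f => vsum f (vmul k f)

theorem conjFun_eq_of_forall_iff {f : ℕ → ℕ} {j c : ℕ} (h : ∀ i, j + 1 ≤ f i ↔ i < c) :
    conjFun f j = c := by
  have hs : {i | j + 1 ≤ f i} = ((Finset.range c : Finset ℕ) : Set ℕ) := by
    ext i
    simp [← h i]
  rw [conjFun, hs, Set.ncard_coe_finset, Finset.card_range]

theorem conjFun_rho (m : ℕ) : conjFun (rho m) = rho m := by
  funext j
  refine conjFun_eq_of_forall_iff fun i => ?_
  simp only [rho]
  omega

theorem vmul_rho_and_conjFun_vmul_rho (q c : ℕ) :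
    (0 < c → vmul c (rho q) = fun i => q - i / c) ∧
      conjFun (vmul c (rho q)) = fun j => c * (q - j) := by
  induction c with
  | zero =>
    refine ⟨fun h => absurd h (lt_irrefl 0), ?_⟩
    funext j
    exact conjFun_eq_of_forall_iff fun i => by simp [vmul]
  | succ c ih =>
    have hv : vmul (c + 1) (rho q) = fun i => q - i / (c + 1) := by
      funext i
      rw [vmul, vsum, ih.2, conjFun_rho]
      refine conjFun_eq_of_forall_iff fun j => ?_
      have hsum : (rho q + fun j => c * (q - j)) j = (q - j) * (c + 1) := by
        simp only [rho, Pi.add_apply]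
        ring
      rw [hsum, Nat.succ_le_iff, ← Nat.div_lt_iff_lt_mul c.add_one_pos]
      generalize i / (c + 1) = b
      omega
    refine ⟨fun _ => hv, ?_⟩
    funext j
    rw [hv]
    refine conjFun_eq_of_forall_iff fun i => ?_
    rw [mul_comm, ← Nat.div_lt_iff_lt_mul c.add_one_pos]
    generalize i / (c + 1) = b
    omega

/-- The Hermite identity for natural numbers. -/
theorem sum_range_add_div {k : ℕ} (hk : 0 < k) (x : ℕ) :
    ∑ j ∈ Finset.range k, (x + j) / k = x := by
  induction x with
  | zero =>
    refine Finset.sum_eq_zero fun j hj => ?_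
    rw [zero_add]
    exact Nat.div_eq_of_lt (Finset.mem_range.mp hj)
  | succ x ih =>
    have h₁ := Finset.sum_range_succ (fun j => (x + j) / k) k
    have h₂ := Finset.sum_range_succ' (fun j => (x + j) / k) k
    have h₃ : ∑ j ∈ Finset.range k, (x + 1 + j) / k =
        ∑ j ∈ Finset.range k, (x + (j + 1)) / k :=
      Finset.sum_congr rfl fun j _ => by rw [add_assoc, add_comm 1 j]
    simp only [Nat.add_div_right x hk, add_zero] at h₁ h₂
    omega

theorem sum_rho_add_div {k : ℕ} (hk : 0 < k) (x : ℕ) :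
    ∑ j ∈ Finset.range k, rho ((x + j) / k) = fun i => x - k * i := by
  funext i
  rw [Finset.sum_apply]
  simp only [rho]
  rcases le_or_gt (k * i) x with h | h
  · obtain ⟨y, rfl⟩ := Nat.exists_eq_add_of_le h
    rw [Nat.add_sub_cancel_left]
    refine Eq.trans (Finset.sum_congr rfl fun j _ => ?_) (sum_range_add_div hk y)
    rw [add_assoc, Nat.mul_add_div hk, Nat.add_sub_cancel_left]
  · rw [Nat.sub_eq_zero_of_le h.le]
    refine Finset.sum_eq_zero fun j hj => Nat.sub_eq_zero_of_le ?_
    rw [← Nat.lt_succ_iff, Nat.div_lt_iff_lt_mul hk, Nat.succ_mul, mul_comm i k]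
    have := Finset.mem_range.mp hj
    omega

theorem add_div_lt_iff_lt_sub_div {d : ℕ} (hd : 0 < d) (i s : ℕ) :
    i + i / d < s ↔ i < s - s / (d + 1) := by
  have hs := Nat.div_add_mod s (d + 1)
  have hr := Nat.mod_lt s (Nat.succ_pos d)
  have hi := Nat.div_add_mod i d
  have he := Nat.mod_lt i hd
  generalize s / (d + 1) = a at *
  generalize s % (d + 1) = r at *
  generalize i / d = b at *
  generalize i % d = e at *
  have hs' : d * a + a + r = s := by rw [← hs]; ring
  rcases lt_trichotomy a b with h | rfl | h
  · have : d * (a + 1) ≤ d * b := Nat.mul_le_mul_left d h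
    rw [mul_add] at this
    omega
  · omega
  · have : d * (b + 1) ≤ d * a := Nat.mul_le_mul_left d h
    rw [mul_add] at this
    omega

/-- For `k ≥ 2` and `n ≥ k - 1`, with `q = ⌊n/(k-1)⌋`:
`(ρ_n +_H ((k-1)_V ρ_q)) +_V (+_H_{i=0}^{k-1} ρ_{⌊(n+q-k+1+i)/k⌋}) = ρ_{n+q}`. -/
theorem staircase_layer_identity_one (n k : ℕ) (hk : 2 ≤ k) (hn : k - 1 ≤ n) :
    vsum (rho n + vmul (k - 1) (rho (n / (k - 1))))
        (∑ i ∈ Finset.range k, rho ((n + n / (k - 1) - k + 1 + i) / k))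
      = rho (n + n / (k - 1)) := by
  obtain ⟨d, rfl⟩ : ∃ d, k = d + 1 := ⟨k - 1, by omega⟩
  rw [Nat.add_sub_cancel] at hn ⊢
  have hd : 0 < d := by omega
  have hq : 0 < n / d := Nat.div_pos hn hd
  rw [(vmul_rho_and_conjFun_vmul_rho _ d).1 hd, sum_rho_add_div d.succ_pos, vsum]
  refine Eq.trans (congrArg conjFun ?_) (conjFun_rho _)
  funext j
  have hf : conjFun (rho n + fun i => n / d - i / d) j =
      n + n / d - j - (n + n / d - j) / (d + 1) := by
    refine conjFun_eq_of_forall_iff fun i => ?_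
    rw [← add_div_lt_iff_lt_sub_div hd]
    simp only [rho, Pi.add_apply]
    rcases le_total i n with h | h <;>
    · have := Nat.div_le_div_right (c := d) h
      generalize i / d = b at *
      generalize n / d = q at *
      omega
  have hg : conjFun (fun i => n + n / d - (d + 1) + 1 - (d + 1) * i) j =
      (n + n / d - j) / (d + 1) := by
    refine conjFun_eq_of_forall_iff fun i => ?_
    rw [Nat.lt_iff_add_one_le, Nat.le_div_iff_mul_le d.add_one_pos, mul_comm (i + 1), mul_add_one]
    generalize (d + 1) * i = p
    generalize n / d = q at *
    omega
  rw [Pi.add_apply, hf, hg]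
  exact Nat.sub_add_cancel (Nat.div_le_self _ _)
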